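/- arXiv:1703.00405 — 3 statements merged into one kernel-verified Lean document; each statement's English description precedes it below -/
import Mathlib

section
/- For a nonnegative square matrix M, the spectral radius of M equals the infimum over positive definite diagonal matrices D of the operator p-norm of D M D^{-1}, for p = 1, 2, or infinity. Moreover the infimum is attained when M is irreducible. -/
open Matrix
open scoped ENNReal

noncomputable def specRad {n : ℕ} (M : Matrix (Fin n) (Fin n) ℝ) : ℝ :=
  (spectralRadius ℂ (M.map (fun x => (x : ℂ)))).toReal

noncomputable def pNorm (p : ℝ≥0∞) [Fact (1 ≤ p)] {n : ℕ} (v : Fin n → ℝ) : ℝ :=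
  ‖(WithLp.equiv p (Fin n → ℝ)).symm v‖

noncomputable def indNorm (p : ℝ≥0∞) [Fact (1 ≤ p)] {n : ℕ}
    (M : Matrix (Fin n) (Fin n) ℝ) : ℝ :=
  sSup {c | ∃ v : Fin n → ℝ, pNorm p v = 1 ∧ c = pNorm p (M.mulVec v)}

def MatIrreducible {n : ℕ} (M : Matrix (Fin n) (Fin n) ℝ) : Prop :=
  ∀ i j : Fin n, ∃ k : ℕ, 0 < (M ^ k) i j

section Gelf
attribute [local instance] Matrix.linftyOpNormedRing Matrix.linftyOpNormedAlgebra

theorem aux_finite {n : ℕ} (A : Matrix (Fin n) (Fin n) ℂ) : spectralRadius ℂ A ≠ ⊤ := by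
  classical
  rcases Nat.eq_zero_or_pos n with h | h
  · subst h
    have : spectralRadius ℂ A = 0 := spectrum.SpectralRadius.of_subsingleton A
    rw [this]
    exact ENNReal.zero_ne_top
  · have : Nonempty (Fin n) := ⟨⟨0, h⟩⟩
    have : CompleteSpace (Matrix (Fin n) (Fin n) ℂ) := FiniteDimensional.complete ℂ _
    exact ne_top_of_le_ne_top ENNReal.coe_ne_top (spectrum.spectralRadius_le_nnnorm (𝕜 := ℂ) A)

theorem aux_gelfand {n : ℕ} (M : Matrix (Fin n) (Fin n) ℝ) (hM : ∀ i j, 0 ≤ M i j) (t : ℝ)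
    (ht : specRad M < t) : ∃ K : ℕ, 0 < K ∧ ∀ i, ∑ j, (M ^ K) i j ≤ t ^ K := by
  classical
  have : CompleteSpace (Matrix (Fin n) (Fin n) ℂ) := FiniteDimensional.complete ℂ _
  set A : Matrix (Fin n) (Fin n) ℂ := M.map (fun x => (x : ℂ)) with hA
  have h0 : 0 ≤ t := le_trans ENNReal.toReal_nonneg ht.le
  have h1 : spectralRadius ℂ A < ENNReal.ofReal t :=
    (ENNReal.lt_ofReal_iff_toReal_lt (aux_finite A)).2 ht
  have h2 := spectrum.pow_nnnorm_pow_one_div_tendsto_nhds_spectralRadius A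
  obtain ⟨K, hK, hK0⟩ := ((h2.eventually (gt_mem_nhds h1)).and (Filter.eventually_gt_atTop 0)).exists
  refine ⟨K, hK0, fun i => ?_⟩
  have h3 : (‖A ^ K‖₊ : ℝ≥0∞) ≤ ENNReal.ofReal t ^ K := by
    have := pow_le_pow_left₀ zero_le hK.le K
    rwa [← ENNReal.rpow_natCast, ← ENNReal.rpow_mul, one_div, inv_mul_cancel₀ (by positivity),
      ENNReal.rpow_one] at this
  have h4 : ‖A ^ K‖ ≤ t ^ K := by
    rw [← ENNReal.ofReal_pow h0] at h3
    have := ENNReal.toReal_mono ENNReal.ofReal_ne_top h3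
    rwa [ENNReal.toReal_ofReal (by positivity)] at this
  have h5 : A ^ K = (M ^ K).map (fun x => (x : ℂ)) := by
    have := Matrix.map_pow M Complex.ofRealHom K
    exact this.symm
  have h6 : ∑ j, ‖(A ^ K) i j‖ ≤ ‖A ^ K‖ := by
    rw [Matrix.linfty_opNorm_def]
    have := Finset.le_sup (f := fun i => ∑ j, ‖(A ^ K) i j‖₊) (Finset.mem_univ i)
    have h7 := NNReal.coe_le_coe.2 this
    rw [NNReal.coe_sum] at h7
    exact h7
  refine le_trans (Finset.sum_le_sum fun j _ => ?_) (h6.trans h4)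
  rw [h5]
  simpa using le_abs_self _
end Gelf

theorem aux_pow_nonneg {n : ℕ} (M : Matrix (Fin n) (Fin n) ℝ) (hM : ∀ i j, 0 ≤ M i j) (k : ℕ) :
    ∀ i j, 0 ≤ (M ^ k) i j := by
  induction k with
  | zero => intro i j; rw [pow_zero, Matrix.one_apply]; split_ifs <;> norm_num
  | succ k ih =>
    intro i j
    rw [pow_succ, Matrix.mul_apply]
    exact Finset.sum_nonneg fun l _ => mul_nonneg (ih _ _) (hM _ _)

theorem aux_super {n : ℕ} (M : Matrix (Fin n) (Fin n) ℝ) (hM : ∀ i j, 0 ≤ M i j) (t : ℝ)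
    (ht : specRad M < t) : ∃ x : Fin n → ℝ, (∀ i, 0 < x i) ∧ ∀ i, (M *ᵥ x) i ≤ t * x i := by
  have h0 : 0 < t := lt_of_le_of_lt ENNReal.toReal_nonneg ht
  obtain ⟨K, hK0, hK⟩ := aux_gelfand M hM t ht
  let y : ℕ → Fin n → ℝ := fun k i => (t ^ k)⁻¹ * ∑ j, (M ^ k) i j
  have hy : ∀ k i, 0 ≤ y k i := fun k i =>
    mul_nonneg (by positivity) (Finset.sum_nonneg fun j _ => aux_pow_nonneg M hM k i j)
  have hy0 : ∀ i, y 0 i = 1 := fun i => by simp [y, Matrix.one_apply]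
  have hyK : ∀ i, y K i ≤ 1 := fun i => by
    have := hK i
    simp only [y]
    rw [inv_mul_le_iff₀ (by positivity)]
    simpa using this
  have hys : ∀ k i, (M *ᵥ y k) i = t * y (k+1) i := fun k i => by
    simp only [y, Matrix.mulVec, dotProduct]
    have : ∑ j, (M ^ (k+1)) i j = ∑ l, M i l * ∑ j, (M ^ k) l j := by
      simp_rw [pow_succ', Matrix.mul_apply, Finset.mul_sum]
      exact Finset.sum_comm
    rw [this, pow_succ, Finset.mul_sum, Finset.mul_sum]
    refine Finset.sum_congr rfl fun l _ => ?_
    field_simp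
  refine ⟨fun i => ∑ k ∈ Finset.range K, y k i, fun i => ?_, fun i => ?_⟩
  · have := Finset.single_le_sum (f := fun k => y k i) (fun k _ => hy k i) (Finset.mem_range.2 hK0)
    simp only [hy0] at this
    linarith
  · have h1 : (M *ᵥ fun i => ∑ k ∈ Finset.range K, y k i) i
        = ∑ k ∈ Finset.range K, (M *ᵥ y k) i := by
      simp only [Matrix.mulVec, dotProduct, Finset.mul_sum]
      exact Finset.sum_comm
    rw [h1]
    simp_rw [hys]
    rw [← Finset.mul_sum]
    refine mul_le_mul_of_nonneg_left ?_ h0.le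
    have h2 := Finset.sum_range_succ (fun k => y k i) K
    have h3 := Finset.sum_range_succ' (fun k => y k i) K
    rw [h2] at h3
    have := hyK i
    rw [hy0] at h3
    linarith

theorem aux_super_irr {n : ℕ} (M : Matrix (Fin n) (Fin n) ℝ) (hM : ∀ i j, 0 ≤ M i j)
    (hI : MatIrreducible M) :
    ∃ x : Fin n → ℝ, (∀ i, 0 < x i) ∧ ∀ i, (M *ᵥ x) i ≤ specRad M * x i := by
  rcases Nat.eq_zero_or_pos n with h | h
  · subst h
    exact ⟨fun _ => 1, fun i => i.elim0, fun i => i.elim0⟩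
  have hne : Nonempty (Fin n) := ⟨⟨0, h⟩⟩
  have key : ∀ k : ℕ, ∃ x ∈ stdSimplex ℝ (Fin n),
      ∀ i, (M *ᵥ x) i ≤ (specRad M + 1 / ((k : ℝ) + 1)) * x i := fun k => by
    obtain ⟨x, hx, hx'⟩ := aux_super M hM (specRad M + 1 / ((k : ℝ) + 1))
      (by have : (0:ℝ) < 1 / ((k : ℝ) + 1) := by positivity
          linarith)
    have hs : 0 < ∑ i, x i := Finset.sum_pos (fun i _ => hx i) Finset.univ_nonempty
    refine ⟨(∑ i, x i)⁻¹ • x, ⟨fun i => ?_, ?_⟩, fun i => ?_⟩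
    · have := hx i
      simp only [Pi.smul_apply, smul_eq_mul]
      positivity
    · simp only [Pi.smul_apply, smul_eq_mul, ← Finset.mul_sum]
      exact inv_mul_cancel₀ hs.ne'
    · rw [Matrix.mulVec_smul]
      simp only [Pi.smul_apply, smul_eq_mul]
      have := mul_le_mul_of_nonneg_left (hx' i) (inv_pos.2 hs).le
      linarith
  choose x hx hx' using key
  obtain ⟨a, ha, φ, hφ, hlim⟩ := (isCompact_stdSimplex ℝ (Fin n)).tendsto_subseq hx
  have hle : ∀ i, (M *ᵥ a) i ≤ specRad M * a i := fun i => by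
    have hc : Continuous fun v : Fin n → ℝ => (M *ᵥ v) i := by
      simp only [Matrix.mulVec, dotProduct]
      fun_prop
    have l1 : Filter.Tendsto (fun k => (M *ᵥ (x (φ k))) i) Filter.atTop (nhds ((M *ᵥ a) i)) :=
      (hc.tendsto a).comp hlim
    have l2 : Filter.Tendsto (fun k => x (φ k) i) Filter.atTop (nhds (a i)) :=
      ((continuous_apply i).tendsto a).comp hlim
    have l3 : Filter.Tendsto (fun k => specRad M + 1 / ((φ k : ℝ) + 1)) Filter.atTop
        (nhds (specRad M + 0)) :=
      tendsto_const_nhds.add ((tendsto_one_div_add_atTop_nhds_zero_nat (𝕜 := ℝ)).comp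
        hφ.tendsto_atTop)
    rw [add_zero] at l3
    exact le_of_tendsto_of_tendsto' l1 (l3.mul l2) fun k => hx' (φ k) i
  have hr : 0 ≤ specRad M := ENNReal.toReal_nonneg
  have hpow : ∀ k i, (M ^ k *ᵥ a) i ≤ specRad M ^ k * a i := fun k => by
    induction k with
    | zero => intro i; simp
    | succ k ih =>
      intro i
      rw [pow_succ', ← Matrix.mulVec_mulVec]
      calc (M *ᵥ (M ^ k *ᵥ a)) i ≤ ∑ j, M i j * (specRad M ^ k * a j) :=
            Finset.sum_le_sum (s := Finset.univ) (f := fun j => M i j * (M ^ k *ᵥ a) j)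
              fun j _ => mul_le_mul_of_nonneg_left (ih j) (hM i j)
        _ = specRad M ^ k * (M *ᵥ a) i := by
            simp only [Matrix.mulVec, dotProduct, Finset.mul_sum]
            exact Finset.sum_congr rfl fun _ _ => by ring
        _ ≤ specRad M ^ k * (specRad M * a i) :=
            mul_le_mul_of_nonneg_left (hle i) (by positivity)
        _ = _ := by ring
  obtain ⟨j, hj⟩ : ∃ j, 0 < a j := by
    by_contra! hcon
    have := Finset.sum_nonpos (s := Finset.univ) (fun i _ => hcon i)
    rw [ha.2] at this
    linarith
  refine ⟨a, fun i => ?_, hle⟩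
  obtain ⟨k, hk⟩ := hI i j
  have h1 : (M ^ k) i j * a j ≤ (M ^ k *ᵥ a) i :=
    Finset.single_le_sum (f := fun j => (M ^ k) i j * a j)
      (fun l _ => mul_nonneg (aux_pow_nonneg M hM k i l) (ha.1 l)) (Finset.mem_univ j)
  have h2 := hpow k i
  have h3 := mul_pos hk hj
  rcases (ha.1 i).eq_or_lt with h4 | h4
  · rw [← h4] at h2
    linarith
  · exact h4

theorem aux_transpose {n : ℕ} (M : Matrix (Fin n) (Fin n) ℝ) : specRad Mᵀ = specRad M := by
  have : spectrum ℂ ((M.map (fun x => (x : ℂ)))ᵀ) = spectrum ℂ (M.map (fun x => (x : ℂ))) := by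
    ext z
    rw [Matrix.mem_spectrum_iff_isRoot_charpoly, Matrix.mem_spectrum_iff_isRoot_charpoly,
      Matrix.charpoly_transpose]
  unfold specRad spectralRadius
  rw [Matrix.transpose_map, this]

theorem pNorm_one {n : ℕ} [Fact ((1:ℝ≥0∞) ≤ 1)] (v : Fin n → ℝ) : pNorm 1 v = ∑ i, |v i| := by
  simp [pNorm, PiLp.norm_eq_of_L1]

theorem pNorm_two {n : ℕ} [Fact ((1:ℝ≥0∞) ≤ 2)] (v : Fin n → ℝ) :
    pNorm 2 v = Real.sqrt (∑ i, v i ^ 2) := by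
  simp [pNorm, PiLp.norm_eq_of_L2]

theorem pNorm_top {n : ℕ} [Fact ((1:ℝ≥0∞) ≤ ⊤)] (v : Fin n → ℝ) : pNorm ⊤ v = ‖v‖ := by
  simp [pNorm, PiLp.norm_toLp]

theorem pNorm_mono {n : ℕ} (p : ℝ≥0∞) [Fact (1 ≤ p)] (hp : p = 1 ∨ p = 2 ∨ p = ⊤)
    (v w : Fin n → ℝ) (h : ∀ i, |v i| ≤ w i) : pNorm p v ≤ pNorm p w := by
  rcases hp with rfl | rfl | rfl
  · rw [pNorm_one, pNorm_one]
    exact Finset.sum_le_sum fun i _ => (h i).trans (le_abs_self _)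
  · rw [pNorm_two, pNorm_two]
    exact Real.sqrt_le_sqrt (Finset.sum_le_sum fun i _ =>
      sq_le_sq.2 ((h i).trans (le_abs_self _)))
  · rw [pNorm_top, pNorm_top]
    refine (pi_norm_le_iff_of_nonneg (norm_nonneg _)).2 fun i => ?_
    exact ((h i).trans (le_abs_self _)).trans (norm_le_pi_norm w i)

theorem pNorm_smul {n : ℕ} (p : ℝ≥0∞) [Fact (1 ≤ p)] (c : ℝ) (v : Fin n → ℝ) :
    pNorm p (c • v) = |c| * pNorm p v := by
  have := norm_smul c ((WithLp.equiv p (Fin n → ℝ)).symm v)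
  exact this

theorem pNorm_pos {n : ℕ} (p : ℝ≥0∞) [Fact (1 ≤ p)] (v : Fin n → ℝ) (hv : v ≠ 0) :
    0 < pNorm p v := by
  unfold pNorm
  rw [norm_pos_iff]
  intro h
  apply hv
  have := congrArg (WithLp.equiv p (Fin n → ℝ)) h
  simpa using this

theorem le_indNorm {n : ℕ} (p : ℝ≥0∞) [Fact (1 ≤ p)] (B : Matrix (Fin n) (Fin n) ℝ)
    (v : Fin n → ℝ) : pNorm p (B *ᵥ v) ≤ indNorm p B * pNorm p v := by
  let f : PiLp p (fun _ : Fin n => ℝ) →ₗ[ℝ] PiLp p (fun _ : Fin n => ℝ) :=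
    (WithLp.linearEquiv p ℝ (Fin n → ℝ)).symm.toLinearMap ∘ₗ Matrix.toLin' B ∘ₗ
      (WithLp.linearEquiv p ℝ (Fin n → ℝ)).toLinearMap
  have hb : BddAbove {c | ∃ v : Fin n → ℝ, pNorm p v = 1 ∧ c = pNorm p (B.mulVec v)} := by
    refine ⟨‖LinearMap.toContinuousLinearMap f‖, ?_⟩
    rintro c ⟨v, hv, rfl⟩
    have := (LinearMap.toContinuousLinearMap f).le_opNorm ((WithLp.equiv p (Fin n → ℝ)).symm v)
    unfold pNorm at hv
    rw [hv, mul_one] at this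
    exact this
  by_cases hv : v = 0
  · subst hv
    simp [pNorm]
  have h := pNorm_pos p v hv
  have h1 : pNorm p (B *ᵥ ((pNorm p v)⁻¹ • v)) ≤ indNorm p B := by
    refine le_csSup hb ⟨_, ?_, rfl⟩
    rw [pNorm_smul, abs_of_pos (inv_pos.2 h), inv_mul_cancel₀ h.ne']
  rw [Matrix.mulVec_smul, pNorm_smul, abs_of_pos (inv_pos.2 h), inv_mul_le_iff₀ h] at h1
  linarith

theorem indNorm_nonneg {n : ℕ} (p : ℝ≥0∞) [Fact (1 ≤ p)] (B : Matrix (Fin n) (Fin n) ℝ) :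
    0 ≤ indNorm p B := by
  refine Real.sSup_nonneg ?_
  rintro c ⟨v, _, rfl⟩
  exact norm_nonneg _

theorem conj_apply {n : ℕ} (M : Matrix (Fin n) (Fin n) ℝ) (d : Fin n → ℝ) (i j : Fin n) :
    (Matrix.diagonal d * M * Matrix.diagonal (fun i => (d i)⁻¹)) i j = d i * M i j * (d j)⁻¹ := by
  simp [Matrix.mul_diagonal, Matrix.diagonal_mul]

theorem aux_lower {n : ℕ} (M : Matrix (Fin n) (Fin n) ℝ) (hM : ∀ i j, 0 ≤ M i j)
    (p : ℝ≥0∞) [Fact (1 ≤ p)] (hp : p = 1 ∨ p = 2 ∨ p = ⊤) (d : Fin n → ℝ) (hd : ∀ i, 0 < d i) :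
    specRad M ≤ indNorm p (Matrix.diagonal d * M * Matrix.diagonal (fun i => (d i)⁻¹)) := by
  set B := Matrix.diagonal d * M * Matrix.diagonal (fun i => (d i)⁻¹) with hB
  refine ENNReal.toReal_le_of_le_ofReal (indNorm_nonneg p B) (iSup₂_le fun z hz => ?_)
  rw [spectrum.mem_iff, Matrix.isUnit_iff_isUnit_det, isUnit_iff_ne_zero, not_not,
    ← Matrix.exists_mulVec_eq_zero_iff] at hz
  obtain ⟨v, hv0, hv⟩ := hz
  rw [Matrix.sub_mulVec, sub_eq_zero, Algebra.algebraMap_eq_smul_one, Matrix.smul_mulVec,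
    Matrix.one_mulVec] at hv
  let w : Fin n → ℝ := fun i => d i * ‖v i‖
  have hw : w ≠ 0 := by
    intro h
    apply hv0
    ext i
    have := congrFun h i
    simpa [w, (hd i).ne'] using this
  have h1 : pNorm p (‖z‖ • w) ≤ pNorm p (B *ᵥ w) := by
    refine pNorm_mono p hp _ _ fun i => ?_
    have hpos : 0 ≤ ‖z‖ * (d i * ‖v i‖) := by have := hd i; positivity
    have e1 : (B *ᵥ w) i = d i * ∑ j, M i j * ‖v j‖ := by
      simp only [Matrix.mulVec, dotProduct, hB, conj_apply, w, Finset.mul_sum]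
      refine Finset.sum_congr rfl fun j _ => ?_
      have := (hd j).ne'
      field_simp
    have e2 : ‖z‖ * ‖v i‖ ≤ ∑ j, M i j * ‖v j‖ := by
      have := congrFun hv i
      simp only [Pi.smul_apply, smul_eq_mul] at this
      rw [← norm_mul, this]
      simp only [Matrix.mulVec, dotProduct]
      refine (norm_sum_le _ _).trans (Finset.sum_le_sum fun j _ => ?_)
      simp [abs_of_nonneg (hM i j)]
    rw [e1]
    simp only [Pi.smul_apply, smul_eq_mul, w]
    rw [abs_of_nonneg hpos]
    have := mul_le_mul_of_nonneg_left e2 (hd i).le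
    linarith
  have h2 := h1.trans (le_indNorm p B w)
  rw [pNorm_smul, abs_of_nonneg (norm_nonneg z)] at h2
  have h3 := le_of_mul_le_mul_right h2 (pNorm_pos p w hw)
  have h4 := ENNReal.ofReal_le_ofReal h3
  rwa [ofReal_norm] at h4

/-- Schur test with a common weight. -/
theorem aux_schur {n : ℕ} (B : Matrix (Fin n) (Fin n) ℝ) (hB : ∀ i j, 0 ≤ B i j)
    (t : ℝ) (ht : 0 ≤ t) (u : Fin n → ℝ) (hu : ∀ i, 0 < u i)
    (h1 : ∀ i, ∑ j, B i j * u j ≤ t * u i) (h2 : ∀ j, ∑ i, u i * B i j ≤ t * u j)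
    (v : Fin n → ℝ) : ∑ i, (B *ᵥ v) i ^ 2 ≤ t ^ 2 * ∑ i, v i ^ 2 := by
  have e1 : ∀ i, (B *ᵥ v) i ^ 2 ≤ t * u i * ∑ j, B i j * (v j ^ 2 / u j) := fun i => by
    have hn : 0 ≤ ∑ j, B i j * (v j ^ 2 / u j) := Finset.sum_nonneg fun j _ => by
      have := hu j; have := hB i j; positivity
    have := Finset.sum_sq_le_sum_mul_sum_of_sq_le_mul Finset.univ
      (r := fun j => B i j * v j) (f := fun j => B i j * u j)
      (g := fun j => B i j * (v j ^ 2 / u j))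
      (fun j _ => by have := hu j; have := hB i j; positivity)
      (fun j _ => by have := hu j; have := hB i j; positivity)
      (fun j _ => le_of_eq (by have := (hu j).ne'; field_simp))
    exact this.trans (mul_le_mul_of_nonneg_right (h1 i) hn)
  calc ∑ i, (B *ᵥ v) i ^ 2 ≤ ∑ i, t * u i * ∑ j, B i j * (v j ^ 2 / u j) :=
        Finset.sum_le_sum fun i _ => e1 i
    _ = ∑ j, t * (v j ^ 2 / u j) * ∑ i, u i * B i j := by
        simp only [Finset.mul_sum]
        rw [Finset.sum_comm]
        exact Finset.sum_congr rfl fun j _ => Finset.sum_congr rfl fun i _ => by ring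
    _ ≤ ∑ j, t * (v j ^ 2 / u j) * (t * u j) := Finset.sum_le_sum fun j _ =>
        mul_le_mul_of_nonneg_left (h2 j) (by have := hu j; positivity)
    _ = t ^ 2 * ∑ i, v i ^ 2 := by
        rw [Finset.mul_sum]
        exact Finset.sum_congr rfl fun j _ => by have := (hu j).ne'; field_simp

theorem indNorm_le {n : ℕ} (p : ℝ≥0∞) [Fact (1 ≤ p)] (B : Matrix (Fin n) (Fin n) ℝ) (t : ℝ)
    (ht : 0 ≤ t) (h : ∀ v, pNorm p (B *ᵥ v) ≤ t * pNorm p v) : indNorm p B ≤ t := by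
  refine Real.sSup_le ?_ ht
  rintro c ⟨v, hv, rfl⟩
  simpa [hv] using h v

theorem aux_upper {n : ℕ} (M : Matrix (Fin n) (Fin n) ℝ) (hM : ∀ i j, 0 ≤ M i j)
    (p : ℝ≥0∞) [Fact (1 ≤ p)] (hp : p = 1 ∨ p = 2 ∨ p = ⊤) (t : ℝ) (ht : 0 ≤ t)
    (x y : Fin n → ℝ) (hx : ∀ i, 0 < x i) (hy : ∀ i, 0 < y i)
    (hMx : ∀ i, (M *ᵥ x) i ≤ t * x i) (hMy : ∀ i, (Mᵀ *ᵥ y) i ≤ t * y i) :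
    ∃ d : Fin n → ℝ, (∀ i, 0 < d i) ∧
      indNorm p (Matrix.diagonal d * M * Matrix.diagonal (fun i => (d i)⁻¹)) ≤ t := by
  simp only [Matrix.mulVec, dotProduct, Matrix.transpose_apply] at hMx hMy
  rcases hp with rfl | rfl | rfl
  · refine ⟨y, hy, indNorm_le _ _ _ ht fun v => ?_⟩
    rw [pNorm_one, pNorm_one]
    simp only [Matrix.mulVec, dotProduct, conj_apply]
    calc ∑ i, |∑ j, y i * M i j * (y j)⁻¹ * v j| ≤ ∑ i, ∑ j, y i * M i j * (y j)⁻¹ * |v j| := by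
          refine Finset.sum_le_sum fun i _ => (Finset.abs_sum_le_sum_abs _ _).trans
            (Finset.sum_le_sum fun j _ => ?_)
          have := hy i; have := hy j; have := hM i j
          rw [abs_mul, abs_of_nonneg (by positivity)]
      _ = ∑ j, ((y j)⁻¹ * |v j|) * ∑ i, M i j * y i := by
          rw [Finset.sum_comm]
          simp only [Finset.mul_sum]
          exact Finset.sum_congr rfl fun j _ => Finset.sum_congr rfl fun i _ => by ring
      _ ≤ ∑ j, ((y j)⁻¹ * |v j|) * (t * y j) := Finset.sum_le_sum fun j _ =>
          mul_le_mul_of_nonneg_left (hMy j) (by have := hy j; positivity)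
      _ = t * ∑ i, |v i| := by
          rw [Finset.mul_sum]
          exact Finset.sum_congr rfl fun j _ => by have := (hy j).ne'; field_simp
  · let a : Fin n → ℝ := fun i => Real.sqrt (x i)
    let b : Fin n → ℝ := fun i => Real.sqrt (y i)
    have ha : ∀ i, 0 < a i := fun i => Real.sqrt_pos.2 (hx i)
    have hb : ∀ i, 0 < b i := fun i => Real.sqrt_pos.2 (hy i)
    have hax : ∀ i, x i = a i ^ 2 := fun i => (Real.sq_sqrt (hx i).le).symm
    have hby : ∀ i, y i = b i ^ 2 := fun i => (Real.sq_sqrt (hy i).le).symm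
    simp only [hax, hby] at hMx hMy
    refine ⟨fun i => b i / a i, fun i => div_pos (hb i) (ha i), indNorm_le _ _ _ ht fun v => ?_⟩
    have := aux_schur (Matrix.diagonal (fun i => b i / a i) * M *
      Matrix.diagonal (fun i => (b i / a i)⁻¹))
      (fun i j => by
        rw [conj_apply]; have := ha i; have := hb i; have := ha j; have := hb j; have := hM i j
        positivity) t ht (fun i => a i * b i) (fun i => mul_pos (ha i) (hb i))
      (fun i => by
        have h := mul_le_mul_of_nonneg_left (hMx i) (div_pos (hb i) (ha i)).le
        have e : b i / a i * (t * a i ^ 2) = t * (a i * b i) := by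
          have := (ha i).ne'; field_simp
        rw [e, Finset.mul_sum] at h
        refine le_trans (le_of_eq (Finset.sum_congr rfl fun j _ => ?_)) h
        have := (ha i).ne'; have := (hb j).ne'; have := (ha j).ne'
        rw [conj_apply]; field_simp)
      (fun j => by
        have h := mul_le_mul_of_nonneg_left (hMy j) (div_pos (ha j) (hb j)).le
        have e : a j / b j * (t * b j ^ 2) = t * (a j * b j) := by
          have := (hb j).ne'; field_simp
        rw [e, Finset.mul_sum] at h
        refine le_trans (le_of_eq (Finset.sum_congr rfl fun i _ => ?_)) h
        have := (ha i).ne'; have := (hb j).ne'; have := (ha j).ne'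
        rw [conj_apply]; field_simp) v
    rw [pNorm_two, pNorm_two]
    refine (Real.sqrt_le_sqrt this).trans (le_of_eq ?_)
    rw [Real.sqrt_mul (by positivity), Real.sqrt_sq ht]
  · refine ⟨fun i => (x i)⁻¹, fun i => inv_pos.2 (hx i), indNorm_le _ _ _ ht fun v => ?_⟩
    rw [pNorm_top, pNorm_top]
    refine (pi_norm_le_iff_of_nonneg (by positivity)).2 fun i => ?_
    simp only [Matrix.mulVec, dotProduct, conj_apply]
    simp only [inv_inv]
    have hxi := hx i
    calc ‖∑ j, (x i)⁻¹ * M i j * x j * v j‖ ≤ ∑ j, ((x i)⁻¹ * ‖v‖) * (M i j * x j) := by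
          refine (norm_sum_le _ _).trans (Finset.sum_le_sum fun j _ => ?_)
          have := hx j; have := hM i j
          rw [norm_mul, Real.norm_of_nonneg (by positivity)]
          have := mul_le_mul_of_nonneg_left (norm_le_pi_norm v j)
            (show 0 ≤ (x i)⁻¹ * M i j * x j by positivity)
          linarith
      _ = ((x i)⁻¹ * ‖v‖) * ∑ j, M i j * x j := by rw [Finset.mul_sum]
      _ ≤ ((x i)⁻¹ * ‖v‖) * (t * x i) := mul_le_mul_of_nonneg_left (hMx i) (by positivity)
      _ = t * ‖v‖ := by field_simp

theorem stmt0 {n : ℕ} (M : Matrix (Fin n) (Fin n) ℝ) (hM : ∀ i j, 0 ≤ M i j)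
    (p : ℝ≥0∞) [Fact (1 ≤ p)] (hp : p = 1 ∨ p = 2 ∨ p = ⊤) :
    specRad M = sInf {c | ∃ d : Fin n → ℝ, (∀ i, 0 < d i) ∧
        c = indNorm p (Matrix.diagonal d * M * Matrix.diagonal (fun i => (d i)⁻¹))} ∧
    (MatIrreducible M → ∃ d : Fin n → ℝ, (∀ i, 0 < d i) ∧
        indNorm p (Matrix.diagonal d * M * Matrix.diagonal (fun i => (d i)⁻¹)) = specRad M) := by
  have hMt : ∀ i j, 0 ≤ Mᵀ i j := fun i j => hM j i
  have hr : 0 ≤ specRad M := ENNReal.toReal_nonneg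
  refine ⟨le_antisymm (le_csInf ⟨_, fun _ => 1, fun _ => one_pos, rfl⟩ ?_) ?_, fun hI => ?_⟩
  · rintro c ⟨d, hd, rfl⟩
    exact aux_lower M hM p hp d hd
  · refine le_of_forall_gt_imp_ge_of_dense fun t ht => ?_
    obtain ⟨x, hx, hx'⟩ := aux_super M hM t ht
    obtain ⟨y, hy, hy'⟩ := aux_super Mᵀ hMt t (by rwa [aux_transpose])
    obtain ⟨d, hd, hd'⟩ := aux_upper M hM p hp t (hr.trans ht.le) x y hx hy hx' hy'
    refine le_trans (csInf_le ⟨0, ?_⟩ ⟨d, hd, rfl⟩) hd'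
    rintro c ⟨d, _, rfl⟩
    exact indNorm_nonneg _ _
  · have hIt : MatIrreducible Mᵀ := fun i j => by
      obtain ⟨k, hk⟩ := hI j i
      exact ⟨k, by rw [← Matrix.transpose_pow]; exact hk⟩
    obtain ⟨x, hx, hx'⟩ := aux_super_irr M hM hI
    obtain ⟨y, hy, hy'⟩ := aux_super_irr Mᵀ hMt hIt
    rw [aux_transpose] at hy'
    obtain ⟨d, hd, hd'⟩ := aux_upper M hM p hp _ hr x y hx hy hx' hy'
    exact ⟨d, hd, le_antisymm hd' (aux_lower M hM p hp d hd)⟩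
end

section
/- Let A₀ be a Metzler matrix and A₁,…,A_N nonnegative matrices. Then the matrix A₀ + Σᵢ Aᵢ is Hurwitz stable if and only if A₀ is Hurwitz stable and the matrix −(Σᵢ Aᵢ)A₀^{-1} is Schur stable. -/
open Matrix

def IsMetzler {n : ℕ} (A : Matrix (Fin n) (Fin n) ℝ) : Prop :=
  ∀ i j : Fin n, i ≠ j → 0 ≤ A i j

def IsHurwitz {n : ℕ} (A : Matrix (Fin n) (Fin n) ℝ) : Prop :=
  ∀ μ ∈ spectrum ℂ (A.map (fun x => (x : ℂ))), μ.re < 0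

def IsSchur {n : ℕ} (M : Matrix (Fin n) (Fin n) ℝ) : Prop := specRad M < 1


/-- Spectrum in terms of eigenvectors. -/
lemma mem_spec_iff {n : ℕ} (C : Matrix (Fin n) (Fin n) ℂ) (μ : ℂ) :
    μ ∈ spectrum ℂ C ↔ ∃ x : Fin n → ℂ, x ≠ 0 ∧ C *ᵥ x = μ • x := by
  rw [spectrum.mem_iff, Matrix.isUnit_iff_isUnit_det, isUnit_iff_ne_zero, not_not,
    ← Matrix.exists_mulVec_eq_zero_iff]
  refine exists_congr fun x => and_congr_right fun _ => ?_
  rw [Matrix.sub_mulVec, sub_eq_zero, Matrix.algebraMap_eq_diagonal]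
  have : (diagonal ((algebraMap ℂ (Fin n → ℂ)) μ)) *ᵥ x = μ • x := by
    ext i; simp [Matrix.mulVec_diagonal]
  rw [this, eq_comm]

/-- weighted positivity -/
lemma weighted_pos {n : ℕ} (v : Fin n → ℝ) (x : Fin n → ℂ) (hv : ∀ i, 0 < v i) (hx : x ≠ 0) :
    0 < ∑ i, v i * ‖x i‖ := by
  obtain ⟨i, hi⟩ := Function.ne_iff.mp hx
  refine Finset.sum_pos' (fun j _ => mul_nonneg (hv j).le (norm_nonneg _)) ⟨i, Finset.mem_univ _, ?_⟩
  exact mul_pos (hv i) (norm_pos_iff.mpr hi)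

lemma hurwitz_of_vec {n : ℕ} (A : Matrix (Fin n) (Fin n) ℝ) (hA : IsMetzler A)
    (v : Fin n → ℝ) (hv : ∀ i, 0 < v i) (h : ∀ j, (v ᵥ* A) j < 0) : IsHurwitz A := by
  intro μ hμ
  obtain ⟨x, hx, hAx⟩ := (mem_spec_iff _ _).1 hμ
  have key : ∀ i, μ.re * ‖x i‖ ≤ ∑ j, A i j * ‖x j‖ := by
    intro i
    have e : (μ - (A i i : ℂ)) * x i = ∑ j ∈ Finset.univ.erase i, (A i j : ℂ) * x j := by
      have := congrFun hAx i
      simp only [mulVec, dotProduct, map_apply, Pi.smul_apply, smul_eq_mul] at this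
      rw [← Finset.add_sum_erase _ _ (Finset.mem_univ i)] at this
      linear_combination -this
    have h1 : (μ.re - A i i) * ‖x i‖ ≤ ‖(μ - (A i i : ℂ)) * x i‖ := by
      rw [norm_mul]
      gcongr
      simpa using Complex.re_le_norm (μ - (A i i : ℂ))
    have h2 : ‖(μ - (A i i : ℂ)) * x i‖ ≤ ∑ j ∈ Finset.univ.erase i, A i j * ‖x j‖ := by
      rw [e]
      refine (norm_sum_le _ _).trans (Finset.sum_le_sum fun j hj => ?_)
      rw [norm_mul, Complex.norm_real, Real.norm_of_nonneg (hA i j (Finset.ne_of_mem_erase hj).symm)]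
    rw [← Finset.add_sum_erase _ _ (Finset.mem_univ i)]
    linarith
  have hpos := weighted_pos v x hv hx
  have hs : μ.re * ∑ i, v i * ‖x i‖ ≤ ∑ j, (v ᵥ* A) j * ‖x j‖ := by
    calc μ.re * ∑ i, v i * ‖x i‖ = ∑ i, v i * (μ.re * ‖x i‖) := by
          rw [Finset.mul_sum]; exact Finset.sum_congr rfl fun i _ => by ring
      _ ≤ ∑ i, v i * ∑ j, A i j * ‖x j‖ :=
          Finset.sum_le_sum fun i _ => mul_le_mul_of_nonneg_left (key i) (hv i).le
      _ = _ := by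
          simp only [vecMul, dotProduct, Finset.mul_sum, Finset.sum_mul]
          rw [Finset.sum_comm]
          exact Finset.sum_congr rfl fun i _ => Finset.sum_congr rfl fun j _ => by ring
  have hneg := weighted_pos (fun j => -(v ᵥ* A) j) x (fun j => by linarith [h j]) hx
  simp only [neg_mul, Finset.sum_neg_distrib] at hneg
  by_contra hc
  have := mul_nonneg (not_lt.1 hc) hpos.le
  linarith

lemma norm_lt_of_vec {n : ℕ} (M : Matrix (Fin n) (Fin n) ℝ) (hM : ∀ i j, 0 ≤ M i j)
    (v : Fin n → ℝ) (hv : ∀ i, 0 < v i) (h : ∀ j, (v ᵥ* M) j < v j) :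
    ∀ μ ∈ spectrum ℂ (M.map (fun x => (x : ℂ))), ‖μ‖ < 1 := by
  intro μ hμ
  obtain ⟨x, hx, hAx⟩ := (mem_spec_iff _ _).1 hμ
  have key : ∀ i, ‖μ‖ * ‖x i‖ ≤ ∑ j, M i j * ‖x j‖ := by
    intro i
    have := congrFun hAx i
    simp only [mulVec, dotProduct, map_apply, Pi.smul_apply, smul_eq_mul] at this
    rw [← norm_mul, ← this]
    refine (norm_sum_le _ _).trans (Finset.sum_le_sum fun j hj => ?_)
    rw [norm_mul, Complex.norm_real, Real.norm_of_nonneg (hM i j)]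
  have hpos := weighted_pos v x hv hx
  have hs : ‖μ‖ * ∑ i, v i * ‖x i‖ ≤ ∑ j, (v ᵥ* M) j * ‖x j‖ := by
    calc ‖μ‖ * ∑ i, v i * ‖x i‖ = ∑ i, v i * (‖μ‖ * ‖x i‖) := by
          rw [Finset.mul_sum]; exact Finset.sum_congr rfl fun i _ => by ring
      _ ≤ ∑ i, v i * ∑ j, M i j * ‖x j‖ :=
          Finset.sum_le_sum fun i _ => mul_le_mul_of_nonneg_left (key i) (hv i).le
      _ = _ := by
          simp only [vecMul, dotProduct, Finset.mul_sum, Finset.sum_mul]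
          rw [Finset.sum_comm]
          exact Finset.sum_congr rfl fun i _ => Finset.sum_congr rfl fun j _ => by ring
  have hneg := weighted_pos (fun j => v j - (v ᵥ* M) j) x (fun j => by linarith [h j]) hx
  simp only [sub_mul, Finset.sum_sub_distrib] at hneg
  by_contra hc
  have := mul_le_mul_of_nonneg_right (not_lt.1 hc) hpos.le
  linarith

section
attribute [local instance] Matrix.linftyOpNormedRing Matrix.linftyOpNormedAlgebra
  Matrix.linftyOpNormedAddCommGroup Matrix.linftyOpNormedSpace

lemma schur_iff {n : ℕ} [NeZero n] (M : Matrix (Fin n) (Fin n) ℝ) :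
    IsSchur M ↔ ∀ μ ∈ spectrum ℂ (M.map (fun x => (x : ℂ))), ‖μ‖ < 1 := by
  unfold IsSchur specRad
  obtain ⟨z, hz, hzr⟩ := spectrum.exists_nnnorm_eq_spectralRadius (M.map (fun x => (x : ℂ)))
  rw [← hzr]
  constructor
  · intro h μ hμ
    have h1 : (‖μ‖₊ : ENNReal) ≤ spectralRadius ℂ (M.map (fun x => (x : ℂ))) :=
      le_iSup₂ (f := fun k (_ : k ∈ spectrum ℂ (M.map (fun x => (x : ℂ)))) => (‖k‖₊ : ENNReal)) μ hμ
    rw [← hzr] at h1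
    have h2 : ‖μ‖ ≤ ‖z‖ := by exact_mod_cast h1
    exact h2.trans_lt (by simpa using h)
  · intro h
    simpa using h z hz

lemma entry_le_norm {n : ℕ} (C : Matrix (Fin n) (Fin n) ℂ) (i j : Fin n) : ‖C i j‖ ≤ ‖C‖ := by
  rw [Matrix.linfty_opNorm_def]
  have h1 : ‖C i j‖₊ ≤ ∑ j, ‖C i j‖₊ :=
    Finset.single_le_sum (f := fun j => ‖C i j‖₊) (fun _ _ => zero_le) (Finset.mem_univ j)
  have h2 := Finset.le_sup (f := fun i => ∑ j, ‖C i j‖₊) (Finset.mem_univ i)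
  exact_mod_cast h1.trans h2

lemma pow_small {n : ℕ} [NeZero n] (C : Matrix (Fin n) (Fin n) ℂ)
    (h : ∀ μ ∈ spectrum ℂ C, ‖μ‖ < 1) (ε : ℝ) (hε : 0 < ε) :
    ∃ k : ℕ, ∀ i j, ‖(C ^ k) i j‖ < ε := by
  have hr : spectralRadius ℂ C < (1 : NNReal) :=
    spectrum.spectralRadius_lt_of_forall_lt C (r := 1) (fun k hk => by exact_mod_cast h k hk)
  have ht := spectrum.pow_nnnorm_pow_one_div_tendsto_nhds_spectralRadius C
  obtain ⟨k, hk, hk1⟩ := ((ht.eventually (gt_mem_nhds hr)).and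
    (Filter.eventually_ge_atTop 1)).exists
  have hk2 : ‖C ^ k‖ < 1 := by
    by_contra hc
    have : (1 : ENNReal) ≤ (‖C ^ k‖₊ : ENNReal) := by exact_mod_cast not_lt.1 hc
    have := ENNReal.one_le_rpow this (z := 1 / (k : ℝ)) (by positivity)
    exact absurd hk (not_lt.2 (by simpa using this))
  obtain ⟨m, hm⟩ := ((tendsto_pow_atTop_nhds_zero_of_norm_lt_one hk2).norm.eventually
    (gt_mem_nhds (by simpa using hε))).exists
  exact ⟨k * m, fun i j => (entry_le_norm _ i j).trans_lt (by simpa [pow_mul] using hm)⟩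
end

lemma exists_vec_of_norm_lt {n : ℕ} [NeZero n] (M : Matrix (Fin n) (Fin n) ℝ)
    (hM : ∀ i j, 0 ≤ M i j)
    (h : ∀ μ ∈ spectrum ℂ (M.map (fun x => (x : ℂ))), ‖μ‖ < 1) :
    ∃ v : Fin n → ℝ, (∀ i, 0 < v i) ∧ ∀ j, (v ᵥ* M) j < v j := by
  have hn : (0 : ℝ) < n := by exact_mod_cast Nat.pos_of_ne_zero (NeZero.ne n)
  obtain ⟨k, hk⟩ := pow_small _ h (1 / n) (by positivity)
  have hmap : ∀ k : ℕ, (M.map (fun x => (x : ℂ))) ^ k = (M ^ k).map (fun x => (x : ℂ)) :=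
    fun k => (map_pow (Complex.ofRealHom.mapMatrix) M k).symm
  have hpow : ∀ k : ℕ, ∀ i j, 0 ≤ (M ^ k) i j := by
    intro k
    induction k with
    | zero => intro i j; rw [pow_zero, Matrix.one_apply]; split_ifs <;> norm_num
    | succ k ih =>
      intro i j
      rw [pow_succ, Matrix.mul_apply]
      exact Finset.sum_nonneg fun l _ => mul_nonneg (ih i l) (hM l j)
  have hlt : ∀ j, ((1 : Fin n → ℝ) ᵥ* M ^ k) j < 1 := by
    intro j
    have : ∀ i, (M ^ k) i j < 1 / n := fun i => by
      have := hk i j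
      rw [hmap, map_apply, Complex.norm_real] at this
      exact (le_abs_self _).trans_lt this
    calc ((1 : Fin n → ℝ) ᵥ* M ^ k) j = ∑ i, (M ^ k) i j := by simp [vecMul, dotProduct]
      _ < ∑ i : Fin n, (1 / n : ℝ) :=
        Finset.sum_lt_sum_of_nonempty Finset.univ_nonempty fun i _ => this i
      _ = 1 := by simp [hn.ne']
  have hk0 : k ≠ 0 := by
    rintro rfl
    have := hlt 0
    simp at this
  have hnn : ∀ m j, 0 ≤ ((1 : Fin n → ℝ) ᵥ* M ^ m) j := fun m j => by
    simp only [vecMul, dotProduct, Pi.one_apply, one_mul]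
    exact Finset.sum_nonneg fun i _ => hpow m i j
  refine ⟨∑ m ∈ Finset.range k, (1 : Fin n → ℝ) ᵥ* M ^ m, fun i => ?_, fun j => ?_⟩
  · rw [Finset.sum_apply]
    refine Finset.sum_pos' (fun m _ => hnn m i) ⟨0, Finset.mem_range.2 (Nat.pos_of_ne_zero hk0), ?_⟩
    simp
  · have e : (∑ m ∈ Finset.range k, (1 : Fin n → ℝ) ᵥ* M ^ m) ᵥ* M + 1
        = (∑ m ∈ Finset.range k, (1 : Fin n → ℝ) ᵥ* M ^ m) + (1 : Fin n → ℝ) ᵥ* M ^ k := by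
      rw [← Finset.sum_range_succ, Finset.sum_range_succ', Matrix.sum_vecMul]
      simp [pow_succ, Matrix.vecMul_vecMul]
    have := congrFun e j
    simp only [Pi.add_apply, Pi.one_apply] at this
    linarith [hlt j]

lemma exists_vec_of_hurwitz {n : ℕ} [NeZero n] (A : Matrix (Fin n) (Fin n) ℝ) (hA : IsMetzler A)
    (h : IsHurwitz A) : ∃ v : Fin n → ℝ, (∀ i, 0 < v i) ∧ ∀ j, (v ᵥ* A) j < 0 := by
  have hfin : (spectrum ℂ (A.map (fun x => (x : ℂ)))).Finite := Matrix.finite_spectrum _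
  have e1 : ∀ᶠ s : ℝ in Filter.atTop, ∀ μ ∈ spectrum ℂ (A.map (fun x => (x : ℂ))),
      ‖μ + s‖ < s := by
    rw [Filter.eventually_all_finite hfin]
    intro μ hμ
    have hre := h μ hμ
    filter_upwards [Filter.eventually_gt_atTop 0,
      Filter.eventually_gt_atTop (‖μ‖ ^ 2 / (-2 * μ.re))] with s hs0 hs
    rw [div_lt_iff₀ (by linarith)] at hs
    refine lt_of_pow_lt_pow_left₀ 2 hs0.le ?_
    rw [← Complex.normSq_eq_norm_sq, Complex.normSq_apply] at *
    simp
    nlinarith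
  have e2 : ∀ᶠ s : ℝ in Filter.atTop, ∀ i, -A i i ≤ s := by
    rw [Filter.eventually_all]
    exact fun i => Filter.eventually_ge_atTop _
  obtain ⟨s, hs1, hs2, hs⟩ := (e1.and (e2.and (Filter.eventually_gt_atTop 0))).exists
  have hsC : (s : ℂ) ≠ 0 := by exact_mod_cast hs.ne'
  obtain ⟨v, hv, hvM⟩ := exists_vec_of_norm_lt (s⁻¹ • A + 1) (fun i j => by
      by_cases hij : i = j
      · subst hij
        have := hs2 i
        have h3 : s⁻¹ * (A i i + s) = s⁻¹ * A i i + 1 := by field_simp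
        simp only [Matrix.add_apply, Matrix.smul_apply, Matrix.one_apply_eq, smul_eq_mul]
        rw [← h3]
        exact mul_nonneg (inv_nonneg.2 hs.le) (by linarith)
      · simp only [Matrix.add_apply, Matrix.smul_apply, Matrix.one_apply_ne hij, smul_eq_mul,
          add_zero]
        exact mul_nonneg (inv_nonneg.2 hs.le) (hA i j hij)) (by
      intro μ hμ
      obtain ⟨x, hx, hxe⟩ := (mem_spec_iff _ _).1 hμ
      have hm : (s⁻¹ • A + 1).map (fun x => (x : ℂ))
          = (s : ℂ)⁻¹ • A.map (fun x => (x : ℂ)) + 1 := by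
        ext i j
        by_cases hij : i = j <;> simp [Matrix.one_apply, hij]
      rw [hm, Matrix.add_mulVec, Matrix.one_mulVec, Matrix.smul_mulVec] at hxe
      have : (s * μ - s) ∈ spectrum ℂ (A.map (fun x => (x : ℂ))) := by
        rw [mem_spec_iff]
        refine ⟨x, hx, ?_⟩
        ext i
        have := congrFun hxe i
        simp only [Pi.add_apply, Pi.smul_apply, smul_eq_mul] at this ⊢
        field_simp at this
        linear_combination this
      have := hs1 _ this
      rw [sub_add_cancel, norm_mul, Complex.norm_real, Real.norm_of_nonneg hs.le] at this
      nlinarith)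
  refine ⟨v, hv, fun j => ?_⟩
  have := hvM j
  rw [Matrix.vecMul_add, Matrix.vecMul_one, Matrix.vecMul_smul] at this
  simp only [Pi.add_apply, Pi.smul_apply, smul_eq_mul] at this
  have h4 : s⁻¹ * (v ᵥ* A) j < 0 := by linarith
  by_contra hc
  have := mul_nonneg (inv_nonneg.2 hs.le) (not_lt.1 hc)
  linarith

/-- Monotonicity of Metzler matrices with a strict left certificate. -/
lemma monotone_of_vec {n : ℕ} (A : Matrix (Fin n) (Fin n) ℝ) (hA : IsMetzler A)
    (v : Fin n → ℝ) (hv : ∀ i, 0 < v i) (h : ∀ j, (v ᵥ* A) j < 0)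
    (x : Fin n → ℝ) (hx : ∀ i, (A *ᵥ x) i ≤ 0) : ∀ i, 0 ≤ x i := by
  classical
  by_contra hc
  push Not at hc
  obtain ⟨i₀, hi₀⟩ := hc
  let T : Finset (Fin n) := Finset.univ.filter fun i => x i < 0
  have hT : ∀ i, i ∈ T ↔ x i < 0 := fun i => by simp [T]
  have h1 : ∑ i ∈ T, v i * (A *ᵥ x) i ≤ 0 :=
    Finset.sum_nonpos fun i _ => mul_nonpos_of_nonneg_of_nonpos (hv i).le (hx i)
  have h2 : ∑ i ∈ T, v i * (A *ᵥ x) i = ∑ j, (∑ i ∈ T, v i * A i j) * x j := by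
    simp only [mulVec, dotProduct, Finset.mul_sum, Finset.sum_mul]
    rw [Finset.sum_comm]
    exact Finset.sum_congr rfl fun i _ => Finset.sum_congr rfl fun j _ => by ring
  have hneg : ∀ j ∈ T, ∑ i ∈ T, v i * A i j < 0 := by
    intro j hj
    refine lt_of_le_of_lt ?_ (h j)
    simp only [vecMul, dotProduct]
    refine Finset.sum_le_sum_of_subset_of_nonneg (Finset.subset_univ _) fun i _ hi => ?_
    exact mul_nonneg (hv i).le (hA i j (by rintro rfl; exact hi hj))
  have h3 : 0 < ∑ j, (∑ i ∈ T, v i * A i j) * x j := by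
    refine Finset.sum_pos' (fun j _ => ?_) ⟨i₀, Finset.mem_univ _, ?_⟩
    · by_cases hj : j ∈ T
      · exact (mul_pos_of_neg_of_neg (hneg j hj) ((hT j).1 hj)).le
      · refine mul_nonneg (Finset.sum_nonneg fun i hi => ?_) (not_lt.1 fun hl => hj ((hT j).2 hl))
        exact mul_nonneg (hv i).le (hA i j (by rintro rfl; exact hj hi))
    · exact mul_pos_of_neg_of_neg (hneg _ ((hT _).2 hi₀)) hi₀
  linarith

lemma inv_of_vec {n : ℕ} (A : Matrix (Fin n) (Fin n) ℝ) (hA : IsMetzler A)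
    (v : Fin n → ℝ) (hv : ∀ i, 0 < v i) (h : ∀ j, (v ᵥ* A) j < 0) :
    IsUnit A.det ∧ ∀ i j, A⁻¹ i j ≤ 0 := by
  have hu : IsUnit A.det := by
    rw [isUnit_iff_ne_zero]
    intro h0
    obtain ⟨x, hx, hAx⟩ := Matrix.exists_mulVec_eq_zero_iff.2 h0
    apply hx
    ext i
    have h1 := monotone_of_vec A hA v hv h x (by simp [hAx]) i
    have h2 := monotone_of_vec A hA v hv h (-x) (by simp [Matrix.mulVec_neg, hAx]) i
    simp only [Pi.neg_apply, Pi.zero_apply] at *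
    linarith
  refine ⟨hu, fun i j => ?_⟩
  have := monotone_of_vec A hA v hv h (-(A⁻¹ *ᵥ Pi.single j 1)) (fun i => by
    rw [Matrix.mulVec_neg, Matrix.mulVec_mulVec, Matrix.mul_nonsing_inv _ hu, Matrix.one_mulVec]
    by_cases hij : i = j
    · subst hij; simp
    · simp [hij]) i
  simpa using this

theorem stmt3 {n N : ℕ} (A₀ : Matrix (Fin n) (Fin n) ℝ) (A : Fin N → Matrix (Fin n) (Fin n) ℝ)
    (hA₀ : IsMetzler A₀) (hA : ∀ i, ∀ k l, 0 ≤ A i k l) :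
    IsHurwitz (A₀ + ∑ i, A i) ↔
      IsHurwitz A₀ ∧ IsSchur (-(∑ i, A i) * A₀⁻¹) := by
  rcases Nat.eq_zero_or_pos n with rfl | hn
  · have hsp : ∀ C : Matrix (Fin 0) (Fin 0) ℂ, spectrum ℂ C = ∅ := fun C =>
      spectrum.of_subsingleton C
    simp [IsHurwitz, IsSchur, specRad, spectralRadius, hsp]
  haveI : NeZero n := ⟨hn.ne'⟩
  have hS : ∀ k l, 0 ≤ (∑ i, A i) k l := fun k l => by
    rw [Matrix.sum_apply]; exact Finset.sum_nonneg fun i _ => hA i k l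
  generalize (∑ i, A i) = S at hS
  have hMet : IsMetzler (A₀ + S) := fun i j hij => add_nonneg (hA₀ i j hij) (hS i j)
  have hMnn : (∀ i j, A₀⁻¹ i j ≤ 0) → ∀ i j, 0 ≤ (-S * A₀⁻¹) i j := by
    intro hi i j
    rw [Matrix.mul_apply]
    refine Finset.sum_nonneg fun l _ => mul_nonneg_of_nonpos_of_nonpos ?_ (hi l j)
    simpa using hS i l
  constructor
  · intro h
    obtain ⟨v, hv, hvA⟩ := exists_vec_of_hurwitz _ hMet h
    have hvA0 : ∀ j, (v ᵥ* A₀) j < 0 := fun j => by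
      have h1 := hvA j
      rw [Matrix.vecMul_add, Pi.add_apply] at h1
      have : 0 ≤ (v ᵥ* S) j := by
        simp only [vecMul, dotProduct]
        exact Finset.sum_nonneg fun i _ => mul_nonneg (hv i).le (hS i j)
      linarith
    obtain ⟨hu, hi⟩ := inv_of_vec A₀ hA₀ v hv hvA0
    refine ⟨hurwitz_of_vec A₀ hA₀ v hv hvA0, (schur_iff _).2 (norm_lt_of_vec _ (hMnn hi) v hv ?_)⟩
    intro j
    have e : (v ᵥ* (A₀ + S)) ᵥ* A₀⁻¹ = v - v ᵥ* (-S * A₀⁻¹) := by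
      rw [Matrix.vecMul_vecMul, Matrix.add_mul, Matrix.mul_nonsing_inv _ hu, Matrix.vecMul_add,
        Matrix.vecMul_one, Matrix.neg_mul, Matrix.vecMul_neg, sub_neg_eq_add]
    have e' := congrFun e j
    have hp : 0 < ((v ᵥ* (A₀ + S)) ᵥ* A₀⁻¹) j := by
      have hex : ∃ i, A₀⁻¹ i j ≠ 0 := by
        by_contra hc
        push Not at hc
        have := congrFun (congrFun (Matrix.mul_nonsing_inv _ hu) j) j
        rw [Matrix.mul_apply] at this
        simp [hc] at this
      obtain ⟨i, hi0⟩ := hex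
      refine Finset.sum_pos' (fun l _ => mul_nonneg_of_nonpos_of_nonpos (hvA l).le (hi l j))
        ⟨i, Finset.mem_univ _, ?_⟩
      exact mul_pos_of_neg_of_neg (hvA i) (lt_of_le_of_ne (hi i j) hi0)
    rw [Pi.sub_apply] at e'
    linarith
  · rintro ⟨h0, hs⟩
    obtain ⟨x, hx, hxA⟩ := exists_vec_of_hurwitz _ hA₀ h0
    obtain ⟨hu, hi⟩ := inv_of_vec A₀ hA₀ x hx hxA
    have hM := hMnn hi
    obtain ⟨w, hw, hwM⟩ := exists_vec_of_norm_lt _ hM ((schur_iff _).1 hs)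
    have hMA : (-S * A₀⁻¹) * A₀ = -S := by
      rw [Matrix.mul_assoc, Matrix.nonsing_inv_mul _ hu, Matrix.mul_one]
    generalize (-S * A₀⁻¹) = M at hM hwM hMA
    obtain ⟨hu1, hi1⟩ := inv_of_vec (M - 1)
      (fun i j hij => by simpa [Matrix.one_apply_ne hij] using hM i j) w hw (fun j => by
        rw [Matrix.vecMul_sub, Matrix.vecMul_one, Pi.sub_apply]; linarith [hwM j])
    let v : Fin n → ℝ := -(x ᵥ* (M - 1)⁻¹)
    have hv0 : ∀ i, 0 ≤ v i := fun i => by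
      have : (x ᵥ* (M - 1)⁻¹) i ≤ 0 := by
        simp only [vecMul, dotProduct]
        exact Finset.sum_nonpos fun l _ =>
          mul_nonpos_of_nonneg_of_nonpos (hx l).le (hi1 l i)
      simpa [v] using this
    have hvx : v ᵥ* (M - 1) = -x := by
      simp only [v]
      rw [Matrix.neg_vecMul, Matrix.vecMul_vecMul, Matrix.nonsing_inv_mul _ hu1, Matrix.vecMul_one]
    have hv : ∀ i, 0 < v i := fun i => by
      have h1 := congrFun hvx i
      rw [Matrix.vecMul_sub, Matrix.vecMul_one, Pi.sub_apply, Pi.neg_apply] at h1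
      have : 0 ≤ (v ᵥ* M) i := by
        simp only [vecMul, dotProduct]
        exact Finset.sum_nonneg fun l _ => mul_nonneg (hv0 l) (hM l i)
      linarith [hx i]
    refine hurwitz_of_vec _ hMet v hv fun j => ?_
    have e : A₀ + S = -((M - 1) * A₀) := by
      rw [Matrix.sub_mul, hMA, Matrix.one_mul]; abel
    rw [e, Matrix.vecMul_neg, ← Matrix.vecMul_vecMul, hvx, Matrix.neg_vecMul, neg_neg]
    exact hxA j
end

section
/- Let A₀ be a Metzler matrix and A₁,…,A_N nonnegative matrices such that A₀ + Σᵢ Aᵢ is Hurwitz stable. Then there exist positive definite diagonal matrices P, Q₁,…,Q_N solving the Riccati inequality A₀ᵀP + PA₀ + Σᵢ (Qᵢ + PAᵢQᵢ^{-1}AᵢᵀP) ≺ 0. -/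
open Matrix

def NegDef {n : ℕ} (M : Matrix (Fin n) (Fin n) ℝ) : Prop := (-M).PosDef


lemma aux_negdef {n : ℕ} (S : Matrix (Fin n) (Fin n) ℝ) (hS : Sᵀ = S) (hM : IsMetzler S)
    (v : Fin n → ℝ) (hv : ∀ i, 0 < v i) (hSv : ∀ i, ∑ j, S i j * v j < 0) : NegDef S := by
  unfold NegDef
  apply Matrix.PosDef.of_dotProduct_mulVec_pos
  · rw [Matrix.IsHermitian, Matrix.conjTranspose_eq_transpose_of_trivial, Matrix.transpose_neg, hS]
  · intro x hx
    have hsym : ∀ i j, S i j = S j i := fun i j => by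
      conv_lhs => rw [← hS]
      rfl
    obtain ⟨k, hk⟩ : ∃ k, x k ≠ 0 := by
      by_contra! h
      exact hx (funext h)
    have e1 : star x ⬝ᵥ (-S) *ᵥ x = -∑ i, ∑ j, S i j * (x i * x j) := by
      simp only [dotProduct, mulVec, star_trivial, Matrix.neg_apply, ← Finset.sum_neg_distrib,
        Finset.mul_sum]
      refine Finset.sum_congr rfl fun i _ => Finset.sum_congr rfl fun j _ => by ring
    have e2 : ∑ i, ∑ j, S i j * (x i * x j) ≤
        ∑ i, ∑ j, S i j * (v j / v i * x i ^ 2 / 2 + v i / v j * x j ^ 2 / 2) := by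
      refine Finset.sum_le_sum fun i _ => Finset.sum_le_sum fun j _ => ?_
      have hi := hv i
      have hj := hv j
      by_cases hij : i = j
      · subst hij
        apply le_of_eq
        field_simp
        ring
      · apply mul_le_mul_of_nonneg_left _ (hM i j hij)
        have : v j / v i * x i ^ 2 / 2 + v i / v j * x j ^ 2 / 2 - x i * x j
            = (v j * x i - v i * x j) ^ 2 / (2 * v i * v j) := by
          field_simp
          ring
        have h2 : 0 ≤ (v j * x i - v i * x j) ^ 2 / (2 * v i * v j) := by positivity
        linarith
    have e3 : ∑ i, ∑ j, S i j * (v j / v i * x i ^ 2 / 2 + v i / v j * x j ^ 2 / 2)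
        = ∑ i, x i ^ 2 / v i * ∑ j, S i j * v j := by
      have a1 : ∑ i, ∑ j, S i j * (v i / v j * x j ^ 2 / 2)
          = ∑ i, ∑ j, S i j * (v j / v i * x i ^ 2 / 2) := by
        rw [Finset.sum_comm]
        refine Finset.sum_congr rfl fun i _ => Finset.sum_congr rfl fun j _ => by
          rw [hsym i j]
      simp only [mul_add, Finset.sum_add_distrib]
      rw [a1, ← Finset.sum_add_distrib]
      refine Finset.sum_congr rfl fun i _ => ?_
      rw [← Finset.sum_add_distrib, Finset.mul_sum]
      refine Finset.sum_congr rfl fun j _ => by ring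
    have e4 : ∑ i, x i ^ 2 / v i * ∑ j, S i j * v j < 0 := by
      apply Finset.sum_neg' 
      · intro i _
        exact mul_nonpos_of_nonneg_of_nonpos (div_nonneg (sq_nonneg _) (hv i).le) (hSv i).le
      · refine ⟨k, Finset.mem_univ k, ?_⟩
        exact mul_neg_of_pos_of_neg (div_pos (by positivity) (hv k)) (hSv k)
    rw [e1]
    linarith

lemma aux_det {n : ℕ} (M : Matrix (Fin n) (Fin n) ℝ) (hH : IsHurwitz M) (s : ℝ)
    (h0 : 0 ≤ s) (h1 : s ≤ 1) :
    ((1 - s) • (1 : Matrix (Fin n) (Fin n) ℝ) - s • M).det ≠ 0 := by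
  rcases h0.eq_or_lt with rfl | hs
  · simp
  · intro hd
    have hnot : ((((1 - s) / s : ℝ)) : ℂ) ∉ spectrum ℂ (M.map (fun x => (x : ℂ))) := by
      intro h
      have := hH _ h
      rw [Complex.ofReal_re] at this
      have : 0 ≤ (1 - s) / s := div_nonneg (by linarith) hs.le
      linarith
    rw [spectrum.notMem_iff, Matrix.isUnit_iff_isUnit_det] at hnot
    have e : (algebraMap ℂ (Matrix (Fin n) (Fin n) ℂ)) (((1 - s) / s : ℝ) : ℂ)
        - M.map (fun x => (x : ℂ)) =
        (s⁻¹ • ((1 - s) • (1 : Matrix (Fin n) (Fin n) ℝ) - s • M)).map (Complex.ofRealHom) := by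
      ext i j
      by_cases hij : i = j
      · subst hij
        simp [Matrix.algebraMap_matrix_apply]
        have : (s : ℂ) ≠ 0 := by exact_mod_cast hs.ne'
        field_simp
      · simp [Matrix.algebraMap_matrix_apply, hij]
        have : (s : ℂ) ≠ 0 := by exact_mod_cast hs.ne'
        field_simp
    rw [e, ← RingHom.mapMatrix_apply, ← RingHom.map_det, Matrix.det_smul, hd] at hnot
    simp at hnot

lemma aux_ivt (f : ℝ → ℝ) (hf : Continuous f) (h0 : 0 < f 0)
    (hne : ∀ s, 0 ≤ s → s ≤ 1 → f s ≠ 0) (s : ℝ) (hs0 : 0 ≤ s) (hs1 : s ≤ 1) : 0 < f s := by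
  by_contra! h
  obtain ⟨c, hc, hc'⟩ := intermediate_value_Icc' hs0 hf.continuousOn ⟨h, h0.le⟩
  exact hne c hc.1 (hc.2.trans hs1) hc'

lemma aux_vec {n : ℕ} (M : Matrix (Fin n) (Fin n) ℝ) (hM : IsMetzler M) (hH : IsHurwitz M) :
    ∃ v : Fin n → ℝ, (∀ i, 0 < v i) ∧ ∀ i, ∑ j, M i j * v j < 0 := by
  rcases Nat.eq_zero_or_pos n with rfl | hn
  · exact ⟨fun _ => 1, fun i => i.elim0, fun i => i.elim0⟩
  haveI : Nonempty (Fin n) := ⟨⟨0, hn⟩⟩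
  set K : ℝ → Matrix (Fin n) (Fin n) ℝ := fun s => (1 - s) • 1 - s • M with hK
  have hKc : Continuous K := by fun_prop
  have hdet : ∀ s, 0 ≤ s → s ≤ 1 → 0 < (K s).det := by
    apply aux_ivt _ hKc.matrix_det
    · simp [hK]
    · exact aux_det M hH
  set u : ℝ → Fin n → ℝ := fun s => (K s).adjugate *ᵥ (fun _ => 1) with hu
  have huc : Continuous u := hKc.matrix_adjugate.matrix_mulVec continuous_const
  have hKu : ∀ s i, ∑ j, K s i j * u s j = (K s).det := by
    intro s i
    have : K s *ᵥ u s = (K s).det • (fun _ => 1) := by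
      rw [hu]
      simp only [Matrix.mulVec_mulVec, Matrix.mul_adjugate, Matrix.smul_mulVec, Matrix.one_mulVec]
    have := congrFun this i
    simpa [mulVec, dotProduct] using this
  have hpos := aux_ivt (fun s => Finset.univ.inf' Finset.univ_nonempty (fun i => u s i))
    (Continuous.finset_inf'_apply _ (fun i _ => (continuous_apply i).comp huc))
    (by simp [hu, hK])
    (by
      intro s h0 h1 hz
      obtain ⟨i, _, hi⟩ := Finset.exists_mem_eq_inf' Finset.univ_nonempty (fun i => u s i)
      have hnn : ∀ j, 0 ≤ u s j := fun j => by
        rw [← hz]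
        exact Finset.inf'_le _ (Finset.mem_univ j)
      have hui : u s i = 0 := by rw [← hi]; exact hz
      have h2 := hKu s i
      have h3 : ∑ j, K s i j * u s j ≤ 0 := by
        apply Finset.sum_nonpos
        intro j _
        by_cases hij : i = j
        · subst hij
          simp [hui]
        · have : K s i j ≤ 0 := by
            simp [hK, hij]
            exact mul_nonneg h0 (hM i j hij)
          exact mul_nonpos_of_nonpos_of_nonneg this (hnn j)
      have := hdet s h0 h1
      linarith)
    1 zero_le_one le_rfl
  refine ⟨u 1, fun i => lt_of_lt_of_le hpos (Finset.inf'_le _ (Finset.mem_univ i)), fun i => ?_⟩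
  have h2 := hKu 1 i
  have h3 := hdet 1 zero_le_one le_rfl
  have h4 : ∑ j, K 1 i j * u 1 j = - ∑ j, M i j * u 1 j := by
    rw [← Finset.sum_neg_distrib]
    refine Finset.sum_congr rfl fun j _ => ?_
    simp [hK]
  linarith

lemma aux_hurwitz_transpose {n : ℕ} (M : Matrix (Fin n) (Fin n) ℝ) (hH : IsHurwitz M) :
    IsHurwitz Mᵀ := by
  intro μ hμ
  apply hH
  rw [spectrum.mem_iff, Matrix.isUnit_iff_isUnit_det] at hμ ⊢
  rw [← Matrix.det_transpose]
  convert hμ using 4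
  ext i j
  simp [Matrix.algebraMap_matrix_apply, eq_comm]
  
lemma aux_eps {n : ℕ} (N : ℕ) (a v : Fin n → ℝ) (hv : ∀ i, 0 < v i) (ha : ∀ i, a i < 0) :
    ∃ ε : ℝ, 0 < ε ∧ ∀ i, a i + N * (ε * v i) < 0 := by
  have h : ∀ i, ∀ᶠ ε : ℝ in nhdsWithin 0 (Set.Ioi 0), a i + N * (ε * v i) < 0 := by
    intro i
    have hc : Continuous fun ε : ℝ => a i + N * (ε * v i) := by fun_prop
    have := hc.tendsto 0
    simp only [zero_mul, mul_zero, add_zero] at this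
    exact (this.mono_left nhdsWithin_le_nhds).eventually_lt_const (ha i)
  have h2 := (Filter.eventually_all.2 h).and self_mem_nhdsWithin
  obtain ⟨ε, h1, h3⟩ := h2.exists
  exact ⟨ε, h3, h1⟩

theorem stmt5 {n N : ℕ} (A₀ : Matrix (Fin n) (Fin n) ℝ) (A : Fin N → Matrix (Fin n) (Fin n) ℝ)
    (hA₀ : IsMetzler A₀) (hA : ∀ i, ∀ k l, 0 ≤ A i k l)
    (hstab : IsHurwitz (A₀ + ∑ i, A i)) :
    ∃ (p : Fin n → ℝ) (q : Fin N → Fin n → ℝ), (∀ i, 0 < p i) ∧ (∀ i k, 0 < q i k) ∧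
      NegDef ((A₀)ᵀ * Matrix.diagonal p + Matrix.diagonal p * A₀ +
        ∑ i, (Matrix.diagonal (q i) +
          Matrix.diagonal p * A i * (Matrix.diagonal (q i))⁻¹ * (A i)ᵀ * Matrix.diagonal p)) := by
  have hM : IsMetzler (A₀ + ∑ i, A i) := by
    intro i j hij
    rw [Matrix.add_apply, Matrix.sum_apply]
    exact add_nonneg (hA₀ i j hij) (Finset.sum_nonneg fun k _ => hA k i j)
  obtain ⟨v, hv, hMv⟩ := aux_vec _ hM hstab
  obtain ⟨w, hw, hMw⟩ := aux_vec (A₀ + ∑ i, A i)ᵀ (fun i j hij => hM j i hij.symm)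
    (aux_hurwitz_transpose _ hstab)
  obtain ⟨p, hp⟩ : ∃ p : Fin n → ℝ, p = fun i => w i / v i := ⟨_, rfl⟩
  have hp0 : ∀ i, 0 < p i := fun i => by rw [hp]; exact div_pos (hw i) (hv i)
  have hpv : ∀ i, p i * v i = w i := fun i => by
    rw [hp]; exact div_mul_cancel₀ _ (hv i).ne'
  obtain ⟨ε, hε, hεb⟩ := aux_eps N
    (fun i => ∑ j, (A₀ + ∑ i, A i)ᵀ i j * w j + p i * ∑ j, (A₀ + ∑ i, A i) i j * v j) v hv
    (fun i => add_neg (hMw i) (mul_neg_of_pos_of_neg (hp0 i) (hMv i)))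
  obtain ⟨b, hb⟩ : ∃ b : Fin N → Fin n → ℝ, b = fun i k => ∑ l, A i l k * w l := ⟨_, rfl⟩
  have hb0 : ∀ i k, 0 ≤ b i k := fun i k => by
    rw [hb]; exact Finset.sum_nonneg fun l _ => mul_nonneg (hA i l k) (hw l).le
  obtain ⟨q, hq⟩ : ∃ q : Fin N → Fin n → ℝ, q = fun i k => b i k / v k + ε := ⟨_, rfl⟩
  have hq0 : ∀ i k, 0 < q i k := fun i k => by
    rw [hq]; exact add_pos_of_nonneg_of_pos (div_nonneg (hb0 i k) (hv k).le) hε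
  have hqv : ∀ i k, q i k * v k = b i k + ε * v k := fun i k => by
    have := (hv k).ne'
    rw [hq]; field_simp
  have hinv : ∀ i, (Matrix.diagonal (q i))⁻¹ = Matrix.diagonal (fun k => (q i k)⁻¹) := by
    intro i
    apply Matrix.inv_eq_right_inv
    rw [Matrix.diagonal_mul_diagonal, ← Matrix.diagonal_one]
    congr 1
    funext k
    exact mul_inv_cancel₀ (hq0 i k).ne'
  refine ⟨p, q, hp0, hq0, ?_⟩
  simp only [hinv]
  have hT : ∀ i k l, (Matrix.diagonal p * A i * Matrix.diagonal (fun k => (q i k)⁻¹) * (A i)ᵀ *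
      Matrix.diagonal p) k l = p k * (∑ m, A i k m * (q i m)⁻¹ * A i l m) * p l := by
    intro i k l
    rw [Matrix.mul_diagonal, Matrix.mul_apply, Finset.mul_sum]
    congr 1
    refine Finset.sum_congr rfl fun m _ => ?_
    rw [Matrix.mul_diagonal, Matrix.diagonal_mul, Matrix.transpose_apply]
    ring
  refine aux_negdef _ ?_ ?_ v hv ?_
  · simp only [Matrix.transpose_add, Matrix.transpose_sum, Matrix.transpose_mul,
      Matrix.transpose_transpose, Matrix.diagonal_transpose, Matrix.mul_assoc]
    rw [add_comm (Matrix.diagonal p * A₀)]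
  · intro k l hkl
    rw [Matrix.add_apply, Matrix.add_apply, Matrix.sum_apply, Matrix.mul_diagonal,
      Matrix.diagonal_mul, Matrix.transpose_apply]
    refine add_nonneg (add_nonneg (mul_nonneg (hA₀ _ _ hkl.symm) (hp0 _).le)
      (mul_nonneg (hp0 _).le (hA₀ _ _ hkl))) (Finset.sum_nonneg fun i _ => ?_)
    rw [Matrix.add_apply, hT, Matrix.diagonal_apply_ne _ hkl, zero_add]
    refine mul_nonneg (mul_nonneg (hp0 _).le (Finset.sum_nonneg fun m _ => ?_)) (hp0 _).le
    exact mul_nonneg (mul_nonneg (hA _ _ _) (inv_nonneg.2 (hq0 _ _).le)) (hA _ _ _)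
  · intro k
    refine lt_of_le_of_lt ?_ (hεb k)
    -- the contribution of each delay term
    have hD : ∀ i, ∑ l, (Matrix.diagonal (q i) + Matrix.diagonal p * A i *
        Matrix.diagonal (fun k => (q i k)⁻¹) * (A i)ᵀ * Matrix.diagonal p) k l * v l
        ≤ b i k + ε * v k + p k * ∑ m, A i k m * v m := by
      intro i
      simp only [Matrix.add_apply, hT, add_mul, Finset.sum_add_distrib]
      have d1 : ∑ l, Matrix.diagonal (q i) k l * v l = b i k + ε * v k := by
        rw [← hqv]
        simp [Matrix.diagonal_apply]
      have d2 : ∑ l, p k * (∑ m, A i k m * (q i m)⁻¹ * A i l m) * p l * v l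
          = p k * ∑ m, A i k m * ((q i m)⁻¹ * b i m) := by
        simp only [hb, Finset.mul_sum, Finset.sum_mul]
        rw [Finset.sum_comm]
        refine Finset.sum_congr rfl fun m _ => Finset.sum_congr rfl fun l _ => ?_
        rw [← hpv l]
        ring
      rw [d1, d2]
      gcongr with m _
      · exact (hp0 k).le
      · exact hA i k m
      · rw [inv_mul_le_iff₀ (hq0 i m), hqv]
        have := mul_pos hε (hv m)
        linarith
    calc _ = ∑ l, A₀ l k * w l + p k * ∑ l, A₀ k l * v l + ∑ i, ∑ l, (Matrix.diagonal (q i) +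
        Matrix.diagonal p * A i *
        Matrix.diagonal (fun k => (q i k)⁻¹) * (A i)ᵀ * Matrix.diagonal p) k l * v l := by
          rw [Finset.sum_comm (s := (Finset.univ : Finset (Fin N))), Finset.mul_sum,
            ← Finset.sum_add_distrib, ← Finset.sum_add_distrib]
          refine Finset.sum_congr rfl fun l _ => ?_
          rw [Matrix.add_apply, Matrix.add_apply, Matrix.sum_apply, Matrix.mul_diagonal,
            Matrix.diagonal_mul, Matrix.transpose_apply, ← hpv l, ← Finset.sum_mul]
          ring
      _ ≤ ∑ l, A₀ l k * w l + p k * ∑ l, A₀ k l * v l +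
          ∑ i, (b i k + ε * v k + p k * ∑ m, A i k m * v m) := by
          gcongr with i _
          exact hD i
      _ = _ := by
          have c1 : ∑ j, (A₀ + ∑ i, A i)ᵀ k j * w j = ∑ l, A₀ l k * w l + ∑ i, b i k := by
            rw [hb, Finset.sum_comm, ← Finset.sum_add_distrib]
            refine Finset.sum_congr rfl fun l _ => ?_
            rw [Matrix.transpose_apply, Matrix.add_apply, Matrix.sum_apply, add_mul,
              Finset.sum_mul]
          have c2 : ∑ j, (A₀ + ∑ i, A i) k j * v j
              = ∑ l, A₀ k l * v l + ∑ i, ∑ m, A i k m * v m := by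
            rw [Finset.sum_comm, ← Finset.sum_add_distrib]
            refine Finset.sum_congr rfl fun l _ => ?_
            rw [Matrix.add_apply, Matrix.sum_apply, add_mul, Finset.sum_mul]
          rw [c1, c2, Finset.sum_add_distrib, Finset.sum_add_distrib, mul_add,
            Finset.mul_sum Finset.univ (fun i => ∑ m, A i k m * v m)]
          simp only [Finset.sum_const, Finset.card_univ, Fintype.card_fin, nsmul_eq_mul]
          ring
end
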